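/- arXiv:2402.02291 — 5 statements merged into one kernel-verified Lean document; each statement's English description precedes it below -/
import Mathlib

section
/- Let K, Θ, T be bounded operators on H such that Θ and T have closed ranges, ker(Θ) = ker(T), and K* maps ran(Θ) into ran(Θ). Let S be a Moore–Penrose inverse of T and assume K(ΘS) = (ΘS)K. If {Υ_ξ ∘ T*}_{ξ∈Ω} is a continuous K-g-frame for ran(T), i.e. there exist 0 < C ≤ D with C‖K* f‖² ≤ ∫_Ω ‖Υ_ξ T* f‖² dν(ξ) ≤ D‖f‖² for every f ∈ ran(T), then {Υ_ξ ∘ Θ*}_{ξ∈Ω} is a continuous K-g-frame for ran(Θ), i.e. there exist 0 < A ≤ B with A‖K* f‖² ≤ ∫_Ω ‖Υ_ξ Θ* f‖² dν(ξ) ≤ B‖f‖² for every f ∈ ran(Θ). -/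
open MeasureTheory ContinuousLinearMap

noncomputable section

/-- `S` is a Moore–Penrose inverse of `T`. -/
def IsMoorePenroseInv {H : Type*} [NormedAddCommGroup H] [InnerProductSpace ℂ H]
    [CompleteSpace H] (T S : H →L[ℂ] H) : Prop :=
  T ∘L S ∘L T = T ∧ S ∘L T ∘L S = S ∧
    adjoint (T ∘L S) = T ∘L S ∧ adjoint (S ∘L T) = S ∘L T

/-- If `A` has closed range and factors as `A = L ∘ T`, then the adjoint of `L` is bounded below
on the range of `A`. -/
theorem exists_norm_le_mul_norm_adjoint {H : Type*} [NormedAddCommGroup H]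
    [InnerProductSpace ℂ H] [CompleteSpace H] {A L T : H →L[ℂ] H}
    (hA : IsClosed (Set.range A)) (hLT : ∀ y, L (T y) = A y) :
    ∃ m : ℝ, 0 < m ∧ ∀ x ∈ Set.range A, ‖x‖ ≤ m * ‖adjoint L x‖ := by
  have hA' : IsClosed (LinearMap.range (A : H →ₗ[ℂ] H) : Set H) := hA
  have : CompleteSpace (LinearMap.range (A : H →ₗ[ℂ] H)) := hA'.completeSpace_coe
  let A' : H →L[ℂ] LinearMap.range (A : H →ₗ[ℂ] H) := A.codRestrict _ fun y => ⟨y, rfl⟩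
  have hsurj : Function.Surjective A' := by
    rintro ⟨x, y, rfl⟩
    exact ⟨y, rfl⟩
  obtain ⟨c, hc, hpre⟩ := A'.exists_preimage_norm_le hsurj
  refine ⟨(‖T‖ + 1) * c, by positivity, fun x hx => ?_⟩
  obtain ⟨y, hy, hyx⟩ := hpre ⟨x, hx⟩
  have hAy : A y = x := congrArg Subtype.val hy
  have hyx : ‖y‖ ≤ c * ‖x‖ := hyx
  rcases (norm_nonneg x).eq_or_lt with h0 | hpos
  · rw [← h0]
    positivity
  have hTy : ‖T y‖ ≤ (‖T‖ + 1) * (c * ‖x‖) :=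
    (T.le_opNorm y).trans (by gcongr; linarith)
  have hinner : ‖x‖ ^ 2 ≤ ‖T y‖ * ‖adjoint L x‖ := by
    calc ‖x‖ ^ 2 = ‖inner ℂ x x‖ := by
          rw [inner_self_eq_norm_sq_to_K]; simp
      _ = ‖inner ℂ (T y) (adjoint L x)‖ := by
          rw [adjoint_inner_right, hLT, hAy]
      _ ≤ _ := norm_inner_le_norm _ _
  refine le_of_mul_le_mul_right ?_ hpos
  calc ‖x‖ * ‖x‖ = ‖x‖ ^ 2 := (sq _).symm
    _ ≤ (‖T‖ + 1) * (c * ‖x‖) * ‖adjoint L x‖ := hinner.trans (by gcongr)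
    _ = (‖T‖ + 1) * c * ‖adjoint L x‖ * ‖x‖ := by ring

theorem stmt4 {Ω H E : Type*} [MeasurableSpace Ω]
    [NormedAddCommGroup H] [InnerProductSpace ℂ H] [CompleteSpace H]
    [NormedAddCommGroup E] [InnerProductSpace ℂ E]
    (ν : Measure Ω) (K Θ T S : H →L[ℂ] H) (Υ : Ω → H →L[ℂ] E)
    (hΘclosed : IsClosed (Set.range ⇑Θ))
    (hTclosed : IsClosed (Set.range ⇑T))
    (hker : LinearMap.ker (Θ : H →ₗ[ℂ] H) = LinearMap.ker (T : H →ₗ[ℂ] H))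
    (hinv : ∀ x ∈ Set.range ⇑Θ, adjoint K x ∈ Set.range ⇑Θ)
    (hMP : IsMoorePenroseInv T S)
    (hcomm : K ∘L (Θ ∘L S) = (Θ ∘L S) ∘L K)
    (hframeT : ∃ C D : ℝ, 0 < C ∧ C ≤ D ∧ ∀ f ∈ Set.range ⇑T,
      Integrable (fun ξ => ‖Υ ξ (adjoint T f)‖ ^ 2) ν ∧
      C * ‖adjoint K f‖ ^ 2 ≤ ∫ ξ, ‖Υ ξ (adjoint T f)‖ ^ 2 ∂ν ∧
      ∫ ξ, ‖Υ ξ (adjoint T f)‖ ^ 2 ∂ν ≤ D * ‖f‖ ^ 2) :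
    ∃ A B : ℝ, 0 < A ∧ A ≤ B ∧ ∀ f ∈ Set.range ⇑Θ,
      Integrable (fun ξ => ‖Υ ξ (adjoint Θ f)‖ ^ 2) ν ∧
      A * ‖adjoint K f‖ ^ 2 ≤ ∫ ξ, ‖Υ ξ (adjoint Θ f)‖ ^ 2 ∂ν ∧
      ∫ ξ, ‖Υ ξ (adjoint Θ f)‖ ^ 2 ∂ν ≤ B * ‖f‖ ^ 2 := by
  obtain ⟨hTST, hSTS, hTS, -⟩ := hMP
  obtain ⟨C, D, hC, hCD, hframe⟩ := hframeT
  set L : H →L[ℂ] H := Θ ∘L S with hL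
  have hLT : L ∘L T = Θ := by
    ext y
    have hmem : S (T y) - y ∈ LinearMap.ker (Θ : H →ₗ[ℂ] H) := by
      rw [hker, LinearMap.mem_ker]
      simpa [sub_eq_zero] using DFunLike.congr_fun hTST y
    simpa [hL, sub_eq_zero] using hmem
  have hΘ (f : H) : adjoint T (adjoint L f) = adjoint Θ f := by
    conv_rhs => rw [← hLT, adjoint_comp, comp_apply]
  have hS : T ∘L S ∘L adjoint S = adjoint S := by
    conv_rhs => rw [← hSTS, adjoint_comp, hTS]
    rfl
  have hran (f : H) : adjoint L f ∈ Set.range T := by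
    refine ⟨S (adjoint S (adjoint Θ f)), ?_⟩
    rw [hL, adjoint_comp, comp_apply]
    exact DFunLike.congr_fun hS (adjoint Θ f)
  have hKL (f : H) : adjoint K (adjoint L f) = adjoint L (adjoint K f) := by
    have h := congrArg (fun M => adjoint M f) hcomm
    simpa only [adjoint_comp, comp_apply] using h.symm
  obtain ⟨m, hm, hbelow⟩ :=
    exists_norm_le_mul_norm_adjoint (L := L) (T := T) hΘclosed fun y => DFunLike.congr_fun hLT y
  refine ⟨C / m ^ 2, max (C / m ^ 2) (D * ‖adjoint L‖ ^ 2), by positivity, le_max_left _ _,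
    fun f hf => ?_⟩
  obtain ⟨hint, hlow, hup⟩ := hframe _ (hran f)
  simp only [hΘ, hKL] at hint hlow hup
  refine ⟨hint, le_trans ?_ hlow, hup.trans ?_⟩
  · rw [div_mul_eq_mul_div, div_le_iff₀ (by positivity), mul_assoc, ← mul_pow, mul_comm _ m]
    have := hbelow _ (hinv f hf)
    gcongr
  · have hD : 0 ≤ D := hC.le.trans hCD
    calc D * ‖adjoint L f‖ ^ 2 ≤ D * (‖adjoint L‖ * ‖f‖) ^ 2 := by
          gcongr
          exact (adjoint L).le_opNorm f
      _ = D * ‖adjoint L‖ ^ 2 * ‖f‖ ^ 2 := by ring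
      _ ≤ _ := by
          gcongr
          exact le_max_right _ _
end
end

section
/- Let K be a bounded operator on H and let {Υ_ξ}_{ξ∈Ω} be a continuous g-Bessel family for H with synthesis operator T_Υ : L²(Ω, ν; E) → H. Then ran(K) = ran(T_Υ) if and only if there exist constants λ₁, λ₂ > 0 such that (1/λ₁)‖K* f‖² ≤ ∫_Ω ‖Υ_ξ f‖² dν(ξ) ≤ λ₂‖K* f‖² for all f ∈ H. -/
open MeasureTheory ContinuousLinearMap

noncomputable section

/-- `Υ` is a continuous g-Bessel family with bound `B`. -/
def IsCgBessel {Ω H E : Type*} [MeasurableSpace Ω]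
    [NormedAddCommGroup H] [InnerProductSpace ℂ H]
    [NormedAddCommGroup E] [InnerProductSpace ℂ E]
    (ν : Measure Ω) (Υ : Ω → H →L[ℂ] E) (B : ℝ) : Prop :=
  0 < B ∧ ∀ h : H, Integrable (fun ξ => ‖Υ ξ h‖ ^ 2) ν ∧
    ∫ ξ, ‖Υ ξ h‖ ^ 2 ∂ν ≤ B * ‖h‖ ^ 2

/-- The hard half of Douglas' range inclusion lemma: an operator whose adjoint dominates
`adjoint S` has a larger range. -/
theorem range_subset_range_of_norm_adjoint_le {X Y H : Type*}
    [NormedAddCommGroup X] [InnerProductSpace ℂ X] [CompleteSpace X]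
    [NormedAddCommGroup Y] [InnerProductSpace ℂ Y] [CompleteSpace Y]
    [NormedAddCommGroup H] [InnerProductSpace ℂ H] [CompleteSpace H]
    {S : X →L[ℂ] H} {T : Y →L[ℂ] H} {c : ℝ}
    (h : ∀ f, ‖adjoint S f‖ ≤ c * ‖adjoint T f‖) : Set.range S ⊆ Set.range T := by
  rintro _ ⟨x, rfl⟩
  let R : H →ₗ[ℂ] Y := (adjoint T : H →L[ℂ] Y)
  let φ : H →ₗ[ℂ] ℂ := (innerSL ℂ (S x) : H →L[ℂ] ℂ)
  have hφ : ∀ f, ‖φ f‖ ≤ ‖x‖ * c * ‖R f‖ := fun f => by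
    change ‖inner ℂ (S x) f‖ ≤ _
    rw [← adjoint_inner_right S]
    calc _ ≤ ‖x‖ * ‖adjoint S f‖ := norm_inner_le_norm _ _
      _ ≤ ‖x‖ * (c * ‖adjoint T f‖) := by gcongr; exact h f
      _ = _ := by rw [mul_assoc]; rfl
  have hker : LinearMap.ker R ≤ LinearMap.ker φ := fun f hf => by
    have := hφ f
    rw [LinearMap.mem_ker.1 hf] at this
    simpa using this
  let ψ : LinearMap.range R →ₗ[ℂ] ℂ :=
    (LinearMap.ker R).liftQ φ hker ∘ₗ R.quotKerEquivRange.symm.toLinearMap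
  have hψ : ∀ f, ψ ⟨R f, f, rfl⟩ = φ f := fun f => by
    change (LinearMap.ker R).liftQ φ hker (R.quotKerEquivRange.symm _) = _
    rw [show R.quotKerEquivRange.symm ⟨R f, f, rfl⟩ = (LinearMap.ker R).mkQ f from
      R.quotKerEquivRange_symm_apply_image f _]
    rfl
  obtain ⟨g, hg, -⟩ := exists_extension_norm_eq (LinearMap.range R)
    (ψ.mkContinuous (‖x‖ * c) (by
      rintro ⟨_, f, rfl⟩
      rw [hψ]
      exact hφ f))
  refine ⟨(InnerProductSpace.toDual ℂ Y).symm g, ext_inner_right ℂ fun f => ?_⟩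
  rw [← adjoint_inner_right T, InnerProductSpace.toDual_symm_apply]
  exact (hg ⟨R f, f, rfl⟩).trans (hψ f)

/-- The other half of Douglas' range inclusion lemma, by uniform boundedness. -/
theorem exists_norm_adjoint_le_of_range_subset_range {X Y H : Type*}
    [NormedAddCommGroup X] [InnerProductSpace ℂ X] [CompleteSpace X]
    [NormedAddCommGroup Y] [InnerProductSpace ℂ Y] [CompleteSpace Y]
    [NormedAddCommGroup H] [InnerProductSpace ℂ H] [CompleteSpace H]
    {S : X →L[ℂ] H} {T : Y →L[ℂ] H} (h : Set.range S ⊆ Set.range T) :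
    ∃ c : ℝ, 0 < c ∧ ∀ f, ‖adjoint S f‖ ≤ c * ‖adjoint T f‖ := by
  have key : ∀ x, ∃ y, ∀ f, ‖inner ℂ (adjoint S f) x‖ ≤ ‖adjoint T f‖ * ‖y‖ := fun x => by
    obtain ⟨y, hy⟩ := h ⟨x, rfl⟩
    refine ⟨y, fun f => ?_⟩
    rw [adjoint_inner_left, ← hy, ← adjoint_inner_left]
    exact norm_inner_le_norm _ _
  obtain ⟨C, hC⟩ := banach_steinhaus
    (g := fun f : {f : H // ‖adjoint T f‖ ≤ 1} => innerSL ℂ (adjoint S f.1)) (by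
      intro x
      obtain ⟨y, hy⟩ := key x
      refine ⟨‖y‖, fun f => ?_⟩
      rw [innerSL_apply_apply]
      exact (hy f.1).trans (mul_le_of_le_one_left (norm_nonneg _) f.2))
  refine ⟨max C 1, by positivity, fun f => ?_⟩
  rcases eq_or_ne ‖adjoint T f‖ 0 with h0 | h0
  · obtain ⟨y, hy⟩ := key (adjoint S f)
    have := hy f
    rw [h0, zero_mul] at this
    rw [inner_self_eq_zero.1 (norm_le_zero_iff.1 this)]
    simp [h0]
  · have hle := hC ⟨((‖adjoint T f‖⁻¹ : ℝ) : ℂ) • f, by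
      rw [map_smul, norm_smul, Complex.norm_real, norm_inv, norm_norm, inv_mul_cancel₀ h0]⟩
    rw [innerSL_apply_norm, map_smul, norm_smul, Complex.norm_real, norm_inv, norm_norm,
      inv_mul_le_iff₀ (lt_of_le_of_ne (norm_nonneg _) h0.symm), mul_comm] at hle
    exact hle.trans (by gcongr; exact le_max_left _ _)

/-- The adjoint of the synthesis operator is the analysis operator, at the level of norms. -/
theorem norm_adjoint_synthesis_sq {Ω H E : Type*} [MeasurableSpace Ω]
    [NormedAddCommGroup H] [InnerProductSpace ℂ H] [CompleteSpace H]
    [NormedAddCommGroup E] [InnerProductSpace ℂ E] [CompleteSpace E]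
    {ν : Measure Ω} {Υ : Ω → H →L[ℂ] E} {T : Lp E 2 ν →L[ℂ] H} {g : H}
    (hmeas : AEStronglyMeasurable (fun ξ => Υ ξ g) ν)
    (hint : Integrable (fun ξ => ‖Υ ξ g‖ ^ 2) ν)
    (hT : ∀ F : Lp E 2 ν,
      (inner ℂ (T F) g : ℂ) = ∫ ξ, (inner ℂ (F ξ) (Υ ξ g) : ℂ) ∂ν) :
    ‖adjoint T g‖ ^ 2 = ∫ ξ, ‖Υ ξ g‖ ^ 2 ∂ν := by
  have hmem : MemLp (fun ξ => Υ ξ g) 2 ν := (memLp_two_iff_integrable_sq_norm hmeas).2 hint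
  have hadj : adjoint T g = hmem.toLp := by
    refine ext_inner_left ℂ fun F => ?_
    rw [adjoint_inner_right, hT, L2.inner_def]
    refine integral_congr_ae ?_
    filter_upwards [hmem.coeFn_toLp] with ξ hξ
    rw [hξ]
  have hinner : (inner ℂ (adjoint T g) (adjoint T g) : ℂ) =
      ((∫ ξ, ‖Υ ξ g‖ ^ 2 ∂ν : ℝ) : ℂ) := by
    rw [hadj, L2.inner_def, ← integral_complex_ofReal]
    refine integral_congr_ae ?_
    filter_upwards [hmem.coeFn_toLp] with ξ hξ
    rw [hξ, inner_self_eq_norm_sq_to_K]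
    simp
  rw [inner_self_eq_norm_sq_to_K] at hinner
  exact Complex.ofReal_injective ((Complex.ofReal_pow _ _).trans hinner)

theorem stmt5 {Ω H E : Type*} [MeasurableSpace Ω]
    [NormedAddCommGroup H] [InnerProductSpace ℂ H] [CompleteSpace H]
    [NormedAddCommGroup E] [InnerProductSpace ℂ E] [CompleteSpace E]
    (ν : Measure Ω) (K : H →L[ℂ] H) (Υ : Ω → H →L[ℂ] E) (B : ℝ)
    (hmeas : ∀ h : H, AEStronglyMeasurable (fun ξ => Υ ξ h) ν)
    (hBessel : IsCgBessel ν Υ B)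
    (T : Lp E 2 ν →L[ℂ] H)
    (hT : ∀ (F : Lp E 2 ν) (g : H),
      (inner ℂ (T F) g : ℂ) = ∫ ξ, (inner ℂ (F ξ) (Υ ξ g) : ℂ) ∂ν) :
    Set.range ⇑K = Set.range ⇑T ↔
      ∃ lam1 lam2 : ℝ, 0 < lam1 ∧ 0 < lam2 ∧ ∀ f : H,
        (1 / lam1) * ‖adjoint K f‖ ^ 2 ≤ ∫ ξ, ‖Υ ξ f‖ ^ 2 ∂ν ∧
        ∫ ξ, ‖Υ ξ f‖ ^ 2 ∂ν ≤ lam2 * ‖adjoint K f‖ ^ 2 := by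
  have hnorm : ∀ f, ∫ ξ, ‖Υ ξ f‖ ^ 2 ∂ν = ‖adjoint T f‖ ^ 2 := fun f =>
    (norm_adjoint_synthesis_sq (hmeas f) (hBessel.2 f).1 fun F => hT F f).symm
  simp only [hnorm]
  constructor
  · intro h
    obtain ⟨c, hc, hKT⟩ := exists_norm_adjoint_le_of_range_subset_range h.subset
    obtain ⟨d, hd, hTK⟩ := exists_norm_adjoint_le_of_range_subset_range h.superset
    refine ⟨c ^ 2, d ^ 2, by positivity, by positivity, fun f => ⟨?_, ?_⟩⟩
    · rw [one_div, inv_mul_le_iff₀ (by positivity), ← mul_pow]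
      gcongr
      exact hKT f
    · rw [← mul_pow]
      gcongr
      exact hTK f
  · rintro ⟨a, b, ha, hb, h⟩
    refine Set.Subset.antisymm
      (range_subset_range_of_norm_adjoint_le (c := √a) fun f => ?_)
      (range_subset_range_of_norm_adjoint_le (c := √b) fun f => ?_)
    · have := (h f).1
      rw [one_div, inv_mul_le_iff₀ ha] at this
      refine (pow_le_pow_iff_left₀ (norm_nonneg _) (by positivity) two_ne_zero).1 ?_
      rwa [mul_pow, Real.sq_sqrt ha.le]
    · refine (pow_le_pow_iff_left₀ (norm_nonneg _) (by positivity) two_ne_zero).1 ?_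
      rw [mul_pow, Real.sq_sqrt hb.le]
      exact (h f).2
end
end

section
/- Let K₁ be a positive bounded operator on H. Suppose {Υ_ξ}_{ξ∈Ω} is a continuous K₁-g-frame for H with bounds A₁, B₁, and {Φ_ξ}_{ξ∈Ω} (Φ_ξ : H → E, with ξ ↦ Φ_ξ h strongly measurable for each h) is a continuous g-Bessel family with bound B₂ which is a K₁-dual of {Υ_ξ}, i.e. ⟨K₁ g, h⟩ = ∫_Ω ⟨Φ_ξ g, Υ_ξ h⟩ dν(ξ) for all g, h ∈ H. Then the family {Υ_ξ + Φ_ξ}_{ξ∈Ω} is a continuous K₁-g-frame for H, with lower bound A₁: for all f ∈ H, A₁‖K₁* f‖² ≤ ∫_Ω ‖(Υ_ξ + Φ_ξ) f‖² dν(ξ), together with a finite upper Bessel bound. -/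
open MeasureTheory ContinuousLinearMap
open scoped ComplexOrder

noncomputable section

/-- `Υ` is a continuous `K`-g-frame for `H` with bounds `A ≤ B`. -/
def IsCKgFrame {Ω H E : Type*} [MeasurableSpace Ω]
    [NormedAddCommGroup H] [InnerProductSpace ℂ H] [CompleteSpace H]
    [NormedAddCommGroup E] [InnerProductSpace ℂ E]
    (ν : Measure Ω) (K : H →L[ℂ] H) (Υ : Ω → H →L[ℂ] E) (A B : ℝ) : Prop :=
  0 < A ∧ A ≤ B ∧ ∀ h : H,
    Integrable (fun ξ => ‖Υ ξ h‖ ^ 2) ν ∧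
    A * ‖adjoint K h‖ ^ 2 ≤ ∫ ξ, ‖Υ ξ h‖ ^ 2 ∂ν ∧
    ∫ ξ, ‖Υ ξ h‖ ^ 2 ∂ν ≤ B * ‖h‖ ^ 2

theorem integrable_norm_add_sq {Ω E : Type*} [MeasurableSpace Ω] [NormedAddCommGroup E]
    {ν : Measure Ω} {u v : Ω → E}
    (hu : AEStronglyMeasurable u ν) (hv : AEStronglyMeasurable v ν)
    (hu2 : Integrable (fun ξ => ‖u ξ‖ ^ 2) ν) (hv2 : Integrable (fun ξ => ‖v ξ‖ ^ 2) ν) :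
    Integrable (fun ξ => ‖u ξ + v ξ‖ ^ 2) ν :=
  (memLp_two_iff_integrable_sq_norm (hu.add hv)).1
    (((memLp_two_iff_integrable_sq_norm hu).2 hu2).add
      ((memLp_two_iff_integrable_sq_norm hv).2 hv2))

theorem integrable_inner_of_integrable_norm_sq {Ω E : Type*} [MeasurableSpace Ω]
    [NormedAddCommGroup E] [InnerProductSpace ℂ E] {ν : Measure Ω} {u v : Ω → E}
    (hu : AEStronglyMeasurable u ν) (hv : AEStronglyMeasurable v ν)
    (hu2 : Integrable (fun ξ => ‖u ξ‖ ^ 2) ν) (hv2 : Integrable (fun ξ => ‖v ξ‖ ^ 2) ν) :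
    Integrable (fun ξ => (inner ℂ (u ξ) (v ξ) : ℂ)) ν := by
  refine (hu2.add hv2).mono' (hu.inner hv) (Filter.Eventually.of_forall fun ξ => ?_)
  have h := norm_inner_le_norm (𝕜 := ℂ) (u ξ) (v ξ)
  simp only [Pi.add_apply]
  nlinarith [sq_nonneg (‖u ξ‖ - ‖v ξ‖), sq_nonneg ‖u ξ‖, sq_nonneg ‖v ξ‖]

theorem integral_norm_sq_le_integral_norm_add_sq {Ω E : Type*} [MeasurableSpace Ω]
    [NormedAddCommGroup E] [InnerProductSpace ℂ E] {ν : Measure Ω} {u v : Ω → E}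
    (hu : AEStronglyMeasurable u ν) (hv : AEStronglyMeasurable v ν)
    (hu2 : Integrable (fun ξ => ‖u ξ‖ ^ 2) ν) (hv2 : Integrable (fun ξ => ‖v ξ‖ ^ 2) ν)
    (h : 0 ≤ (∫ ξ, (inner ℂ (v ξ) (u ξ) : ℂ) ∂ν).re) :
    ∫ ξ, ‖u ξ‖ ^ 2 ∂ν ≤ ∫ ξ, ‖u ξ + v ξ‖ ^ 2 ∂ν := by
  have hint := integrable_inner_of_integrable_norm_sq hv hu hv2 hu2
  have hre : Integrable (fun ξ => 2 * (inner ℂ (v ξ) (u ξ) : ℂ).re) ν := hint.re.const_mul 2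
  have hcross : 0 ≤ ∫ ξ, 2 * (inner ℂ (v ξ) (u ξ) : ℂ).re ∂ν := by
    have hc : ∫ ξ, (inner ℂ (v ξ) (u ξ) : ℂ).re ∂ν
        = (∫ ξ, (inner ℂ (v ξ) (u ξ) : ℂ) ∂ν).re := integral_re hint
    rw [integral_const_mul, hc]
    positivity
  calc ∫ ξ, ‖u ξ‖ ^ 2 ∂ν
      ≤ ∫ ξ, ‖u ξ‖ ^ 2 ∂ν + ∫ ξ, 2 * (inner ℂ (v ξ) (u ξ) : ℂ).re ∂ν :=
        le_add_of_nonneg_right hcross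
    _ = ∫ ξ, (‖u ξ‖ ^ 2 + 2 * (inner ℂ (v ξ) (u ξ) : ℂ).re) ∂ν := (integral_add hu2 hre).symm
    _ ≤ ∫ ξ, ‖u ξ + v ξ‖ ^ 2 ∂ν := by
        refine integral_mono (hu2.add hre) (integrable_norm_add_sq hu hv hu2 hv2) fun ξ => ?_
        have hsq := norm_add_sq (𝕜 := ℂ) (v ξ) (u ξ)
        rw [add_comm (v ξ)] at hsq
        simp only [RCLike.re_to_complex] at hsq
        nlinarith [sq_nonneg ‖v ξ‖]

theorem integral_norm_add_sq_le {Ω E : Type*} [MeasurableSpace Ω] [NormedAddCommGroup E]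
    {ν : Measure Ω} {u v : Ω → E}
    (hu : AEStronglyMeasurable u ν) (hv : AEStronglyMeasurable v ν)
    (hu2 : Integrable (fun ξ => ‖u ξ‖ ^ 2) ν) (hv2 : Integrable (fun ξ => ‖v ξ‖ ^ 2) ν) :
    ∫ ξ, ‖u ξ + v ξ‖ ^ 2 ∂ν ≤ 2 * (∫ ξ, ‖u ξ‖ ^ 2 ∂ν + ∫ ξ, ‖v ξ‖ ^ 2 ∂ν) := by
  rw [← integral_add hu2 hv2, ← integral_const_mul]
  refine integral_mono (integrable_norm_add_sq hu hv hu2 hv2) ((hu2.add hv2).const_mul 2)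
    fun ξ => ?_
  have h := norm_add_le (u ξ) (v ξ)
  simp only
  nlinarith [sq_nonneg (‖u ξ‖ - ‖v ξ‖), norm_nonneg (u ξ + v ξ)]

theorem stmt11 {Ω H E : Type*} [MeasurableSpace Ω]
    [NormedAddCommGroup H] [InnerProductSpace ℂ H] [CompleteSpace H]
    [NormedAddCommGroup E] [InnerProductSpace ℂ E]
    (ν : Measure Ω) (K1 : H →L[ℂ] H) (Υ Φ : Ω → H →L[ℂ] E) (A1 B1 B2 : ℝ)
    (hmeasΥ : ∀ h : H, AEStronglyMeasurable (fun ξ => Υ ξ h) ν)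
    (hmeasΦ : ∀ h : H, AEStronglyMeasurable (fun ξ => Φ ξ h) ν)
    (hpos : ∀ f : H, 0 ≤ (inner ℂ (K1 f) f : ℂ))
    (hframe : IsCKgFrame ν K1 Υ A1 B1)
    (hBessel : IsCgBessel ν Φ B2)
    (hdual : ∀ g h : H,
      (inner ℂ (K1 g) h : ℂ) = ∫ ξ, (inner ℂ (Φ ξ g) (Υ ξ h) : ℂ) ∂ν) :
    (∀ f : H, Integrable (fun ξ => ‖(Υ ξ + Φ ξ) f‖ ^ 2) ν ∧
      A1 * ‖adjoint K1 f‖ ^ 2 ≤ ∫ ξ, ‖(Υ ξ + Φ ξ) f‖ ^ 2 ∂ν) ∧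
    ∃ B : ℝ, 0 < B ∧ ∀ f : H, ∫ ξ, ‖(Υ ξ + Φ ξ) f‖ ^ 2 ∂ν ≤ B * ‖f‖ ^ 2 := by
  obtain ⟨hA1, hAB, hΥ⟩ := hframe
  obtain ⟨hB2, hΦ⟩ := hBessel
  simp only [_root_.add_apply]
  refine ⟨fun f => ⟨integrable_norm_add_sq (hmeasΥ f) (hmeasΦ f) (hΥ f).1 (hΦ f).1,
    (hΥ f).2.1.trans ?_⟩, 2 * (B1 + B2), by linarith, fun f => ?_⟩
  · refine integral_norm_sq_le_integral_norm_add_sq (hmeasΥ f) (hmeasΦ f) (hΥ f).1 (hΦ f).1 ?_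
    rw [← hdual f f]
    exact (Complex.le_def.1 (hpos f)).1
  · have h := integral_norm_add_sq_le (hmeasΥ f) (hmeasΦ f) (hΥ f).1 (hΦ f).1
    linarith [(hΥ f).2.2, (hΦ f).2]
end
end

section
/- Let K₁ and K₂ be bounded operators on H. Suppose {Υ_ξ}_{ξ∈Ω} is a continuous K₁-g-frame for H, {Φ_ξ}_{ξ∈Ω} (Φ_ξ : H → E, with ξ ↦ Φ_ξ h strongly measurable for each h) is a continuous (K₁ + K₂)-g-frame for H, and the two families are cross-orthogonal: ∫_Ω ⟨Υ_ξ f, Φ_ξ g⟩ dν(ξ) = 0 for all f, g ∈ H. Then {Υ_ξ + Φ_ξ}_{ξ∈Ω} is a continuous (K₁ + K₂)-g-frame for H. -/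
open MeasureTheory ContinuousLinearMap

noncomputable section

/-- The inner product of two square-integrable functions is integrable. -/
theorem integrable_inner_of_sq_norm {Ω E : Type*} [MeasurableSpace Ω]
    [NormedAddCommGroup E] [InnerProductSpace ℂ E] {ν : Measure Ω} {f g : Ω → E}
    (hfm : AEStronglyMeasurable f ν) (hgm : AEStronglyMeasurable g ν)
    (hf : Integrable (fun ξ => ‖f ξ‖ ^ 2) ν) (hg : Integrable (fun ξ => ‖g ξ‖ ^ 2) ν) :
    Integrable (fun ξ => (inner ℂ (f ξ) (g ξ) : ℂ)) ν := by
  refine (hf.add hg).mono' (hfm.inner hgm) (.of_forall fun ξ => ?_)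
  simp only [Pi.add_apply]
  nlinarith [norm_inner_le_norm (𝕜 := ℂ) (f ξ) (g ξ), sq_nonneg (‖f ξ‖ - ‖g ξ‖),
    sq_nonneg ‖f ξ‖, sq_nonneg ‖g ξ‖]

/-- The Pythagorean identity for square-integrable functions. -/
theorem integral_sq_norm_add_of_orthogonal {Ω E : Type*} [MeasurableSpace Ω]
    [NormedAddCommGroup E] [InnerProductSpace ℂ E] {ν : Measure Ω} {f g : Ω → E}
    (hfm : AEStronglyMeasurable f ν) (hgm : AEStronglyMeasurable g ν)
    (hf : Integrable (fun ξ => ‖f ξ‖ ^ 2) ν) (hg : Integrable (fun ξ => ‖g ξ‖ ^ 2) ν)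
    (hfg : ∫ ξ, (inner ℂ (f ξ) (g ξ) : ℂ) ∂ν = 0) :
    Integrable (fun ξ => ‖f ξ + g ξ‖ ^ 2) ν ∧
      ∫ ξ, ‖f ξ + g ξ‖ ^ 2 ∂ν = ∫ ξ, ‖f ξ‖ ^ 2 ∂ν + ∫ ξ, ‖g ξ‖ ^ 2 ∂ν := by
  have hi := integrable_inner_of_sq_norm hfm hgm hf hg
  have hre : Integrable (fun ξ => 2 * RCLike.re (inner ℂ (f ξ) (g ξ) : ℂ)) ν :=
    hi.re.const_mul 2
  have hzero : ∫ ξ, 2 * RCLike.re (inner ℂ (f ξ) (g ξ) : ℂ) ∂ν = 0 := by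
    rw [integral_const_mul, integral_re hi, hfg]
    simp
  have hsq : (fun ξ => ‖f ξ + g ξ‖ ^ 2) =
      fun ξ => ‖f ξ‖ ^ 2 + 2 * RCLike.re (inner ℂ (f ξ) (g ξ) : ℂ) + ‖g ξ‖ ^ 2 :=
    funext fun ξ => norm_add_sq (𝕜 := ℂ) (f ξ) (g ξ)
  rw [hsq]
  have hsum : Integrable
      (fun ξ => ‖f ξ‖ ^ 2 + 2 * RCLike.re (inner ℂ (f ξ) (g ξ) : ℂ)) ν := hf.add hre
  refine ⟨hsum.add hg, ?_⟩
  rw [integral_add hsum hg, integral_add hf hre, hzero, add_zero]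

theorem stmt12 {Ω H E : Type*} [MeasurableSpace Ω]
    [NormedAddCommGroup H] [InnerProductSpace ℂ H] [CompleteSpace H]
    [NormedAddCommGroup E] [InnerProductSpace ℂ E]
    (ν : Measure Ω) (K1 K2 : H →L[ℂ] H) (Υ Φ : Ω → H →L[ℂ] E)
    (hmeasΥ : ∀ h : H, AEStronglyMeasurable (fun ξ => Υ ξ h) ν)
    (hmeasΦ : ∀ h : H, AEStronglyMeasurable (fun ξ => Φ ξ h) ν)
    (hΥ : ∃ A B : ℝ, IsCKgFrame ν K1 Υ A B)
    (hΦ : ∃ A B : ℝ, IsCKgFrame ν (K1 + K2) Φ A B)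
    (hortho : ∀ f g : H, ∫ ξ, (inner ℂ (Υ ξ f) (Φ ξ g) : ℂ) ∂ν = 0) :
    ∃ A B : ℝ, IsCKgFrame ν (K1 + K2) (fun ξ => Υ ξ + Φ ξ) A B := by
  obtain ⟨A₁, B₁, hA₁, hAB₁, h₁⟩ := hΥ
  obtain ⟨A₂, B₂, hA₂, hAB₂, h₂⟩ := hΦ
  refine ⟨A₂, B₁ + B₂, hA₂, by linarith, fun h => ?_⟩
  obtain ⟨hint₁, -, hupper₁⟩ := h₁ h
  obtain ⟨hint₂, hlower₂, hupper₂⟩ := h₂ h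
  obtain ⟨hint, heq⟩ := integral_sq_norm_add_of_orthogonal (hmeasΥ h) (hmeasΦ h)
    hint₁ hint₂ (hortho h h)
  have hnonneg : 0 ≤ ∫ ξ, ‖Υ ξ h‖ ^ 2 ∂ν := integral_nonneg fun ξ => sq_nonneg _
  simp only [_root_.add_apply]
  exact ⟨hint, by linarith, by linarith⟩
end
end

section
/- Let K₁ be a bounded operator on H with closed range, let K₂ be a bounded operator on a complex Hilbert space H₂, let Θ₁, Θ₂ : H → H₂ be bounded operators, and let α₁, α₂ > 0. Let {Υ_ξ}_{ξ∈Ω} and {Φ_ξ}_{ξ∈Ω} be continuous K₁-g-frames for H (values in E) such that for every g ∈ H₂: Re ∫_Ω ⟨Υ_ξ Θ₁* g, Φ_ξ Θ₂* g⟩ dν(ξ) ≥ 0. Set P = α₁Θ₁ + α₂Θ₂ and assume ran(K₂) ⊆ ran(P) and ran(P*) ⊆ ran(K₁). Then {α₁ Υ_ξ Θ₁* + α₂ Φ_ξ Θ₂*}_{ξ∈Ω} is a continuous K₂-g-frame for H₂. -/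
open MeasureTheory ContinuousLinearMap

noncomputable section

/-- The inequality in Douglas' range inclusion theorem. -/
theorem exists_norm_adjoint_le_of_range_subset {F G H : Type*}
    [NormedAddCommGroup F] [InnerProductSpace ℂ F] [CompleteSpace F]
    [NormedAddCommGroup G] [InnerProductSpace ℂ G] [CompleteSpace G]
    [NormedAddCommGroup H] [InnerProductSpace ℂ H] [CompleteSpace H]
    (S : F →L[ℂ] H) (T : G →L[ℂ] H) (h : Set.range ⇑S ⊆ Set.range ⇑T) :
    ∃ C : ℝ, 0 < C ∧ ∀ y, ‖adjoint S y‖ ≤ C * ‖adjoint T y‖ := by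
  have key (x : F) : ∃ z : G, ∀ y, ‖(inner ℂ (adjoint S y) x : ℂ)‖ ≤ ‖adjoint T y‖ * ‖z‖ := by
    obtain ⟨z, hz⟩ := h ⟨x, rfl⟩
    refine ⟨z, fun y => ?_⟩
    rw [adjoint_inner_left, ← hz, ← adjoint_inner_left]
    exact norm_inner_le_norm _ _
  obtain ⟨C, hC⟩ := banach_steinhaus
    (g := fun y : H => innerSL ℂ (((‖adjoint T y‖⁻¹ : ℝ) : ℂ) • adjoint S y)) (by
      intro x
      obtain ⟨z, hz⟩ := key x
      refine ⟨‖z‖, fun y => ?_⟩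
      rw [innerSL_apply_apply, inner_smul_left, norm_mul, RCLike.norm_conj, Complex.norm_real,
        norm_inv, norm_norm]
      rcases (norm_nonneg (adjoint T y)).eq_or_lt with h0 | h0
      · simp [← h0]
      · rw [inv_mul_le_iff₀ h0]
        exact hz y)
  refine ⟨max C 1, by positivity, fun y => ?_⟩
  rcases (norm_nonneg (adjoint T y)).eq_or_lt with h0 | h0
  · obtain ⟨z, hz⟩ := key (adjoint S y)
    have h1 := hz y
    rw [← h0, zero_mul, norm_le_zero_iff, inner_self_eq_zero] at h1
    simp [h1, ← h0]
  · have h1 := hC y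
    rw [innerSL_apply_norm, norm_smul, Complex.norm_real, norm_inv, norm_norm,
      inv_mul_le_iff₀ h0, mul_comm] at h1
    exact h1.trans (by gcongr; exact le_max_left _ _)

/-- The adjoint of a closed range operator is bounded below on that range. -/
theorem exists_norm_le_norm_adjoint_of_isClosed_range {G H : Type*}
    [NormedAddCommGroup G] [InnerProductSpace ℂ G] [CompleteSpace G]
    [NormedAddCommGroup H] [InnerProductSpace ℂ H] [CompleteSpace H]
    (T : G →L[ℂ] H) (hT : IsClosed (Set.range ⇑T)) :
    ∃ C : ℝ, 0 < C ∧ ∀ y ∈ Set.range ⇑T, ‖y‖ ≤ C * ‖adjoint T y‖ := by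
  let R : Submodule ℂ H := LinearMap.range (T : G →ₗ[ℂ] H)
  have hR : IsClosed (R : Set H) := hT
  have : CompleteSpace R := hR.completeSpace_coe
  obtain ⟨C, hC, hle⟩ := exists_norm_adjoint_le_of_range_subset R.subtypeL T (by
    rintro _ ⟨⟨x, z, hz⟩, rfl⟩
    exact ⟨z, hz⟩)
  refine ⟨C, hC, ?_⟩
  rintro y ⟨z, rfl⟩
  have h1 := hle (T z)
  have h2 : adjoint R.subtypeL (T z) = ⟨T z, z, rfl⟩ := by
    rw [Submodule.adjoint_subtypeL]
    exact Submodule.orthogonalProjectionOnto_mem_subspace_eq_self (K := R) ⟨T z, z, rfl⟩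
  rwa [h2] at h1

section SquareIntegrable

variable {Ω E : Type*} [MeasurableSpace Ω] [NormedAddCommGroup E]
  {ν : Measure Ω} {u v : Ω → E}

theorem integral_norm_add_sq [InnerProductSpace ℂ E] (hu : MemLp u 2 ν) (hv : MemLp v 2 ν) :
    ∫ ξ, ‖u ξ + v ξ‖ ^ 2 ∂ν =
      ∫ ξ, ‖u ξ‖ ^ 2 ∂ν + 2 * (∫ ξ, (inner ℂ (u ξ) (v ξ) : ℂ) ∂ν).re +
        ∫ ξ, ‖v ξ‖ ^ 2 ∂ν := by
  have hi : Integrable (fun ξ => (inner ℂ (u ξ) (v ξ) : ℂ)) ν :=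
    memLp_one_iff_integrable.1 <| hu.of_bilin (fun x y => inner ℂ x y) 1 hv (hu.1.inner hv.1)
      (.of_forall fun ξ => by simpa using nnnorm_inner_le_nnnorm (𝕜 := ℂ) (u ξ) (v ξ))
  have hre : ∫ ξ, (inner ℂ (u ξ) (v ξ) : ℂ).re ∂ν = (∫ ξ, (inner ℂ (u ξ) (v ξ) : ℂ) ∂ν).re :=
    integral_re hi
  have hi' : Integrable (fun ξ => 2 * (inner ℂ (u ξ) (v ξ) : ℂ).re) ν := hi.re.const_mul 2
  have hu' := (memLp_two_iff_integrable_sq_norm hu.1).1 hu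
  have hv' := (memLp_two_iff_integrable_sq_norm hv.1).1 hv
  simp_rw [norm_add_sq (𝕜 := ℂ), RCLike.re_eq_complex_re]
  rw [integral_add (by exact hu'.add hi') hv', integral_add hu' hi', integral_const_mul, hre]

theorem integral_norm_add_sq_le_s14 (hu : MemLp u 2 ν) (hv : MemLp v 2 ν) :
    ∫ ξ, ‖u ξ + v ξ‖ ^ 2 ∂ν ≤ 2 * ∫ ξ, ‖u ξ‖ ^ 2 ∂ν + 2 * ∫ ξ, ‖v ξ‖ ^ 2 ∂ν := by
  have hu' := ((memLp_two_iff_integrable_sq_norm hu.1).1 hu).const_mul 2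
  have hv' := ((memLp_two_iff_integrable_sq_norm hv.1).1 hv).const_mul 2
  rw [← integral_const_mul, ← integral_const_mul, ← integral_add hu' hv']
  refine integral_mono ((memLp_two_iff_integrable_sq_norm (hu.add hv).1).1 (hu.add hv))
    (hu'.add hv') fun ξ => ?_
  have h1 := norm_add_le (u ξ) (v ξ)
  dsimp only
  nlinarith [norm_nonneg (u ξ + v ξ), sq_nonneg (‖u ξ‖ - ‖v ξ‖)]

end SquareIntegrable

theorem stmt14 {Ω H H2 E : Type*} [MeasurableSpace Ω]
    [NormedAddCommGroup H] [InnerProductSpace ℂ H] [CompleteSpace H]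
    [NormedAddCommGroup H2] [InnerProductSpace ℂ H2] [CompleteSpace H2]
    [NormedAddCommGroup E] [InnerProductSpace ℂ E]
    (ν : Measure Ω) (K1 : H →L[ℂ] H) (K2 : H2 →L[ℂ] H2)
    (Θ1 Θ2 : H →L[ℂ] H2) (Υ Φ : Ω → H →L[ℂ] E) (α1 α2 : ℝ)
    (hα1 : 0 < α1) (hα2 : 0 < α2)
    (hmeasΥ : ∀ h : H, AEStronglyMeasurable (fun ξ => Υ ξ h) ν)
    (hmeasΦ : ∀ h : H, AEStronglyMeasurable (fun ξ => Φ ξ h) ν)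
    (hK1closed : IsClosed (Set.range ⇑K1))
    (hΥ : ∃ A B : ℝ, IsCKgFrame ν K1 Υ A B)
    (hΦ : ∃ A B : ℝ, IsCKgFrame ν K1 Φ A B)
    (hpos : ∀ g : H2,
      0 ≤ (∫ ξ, (inner ℂ (Υ ξ (adjoint Θ1 g)) (Φ ξ (adjoint Θ2 g)) : ℂ) ∂ν).re)
    (hranK2 : Set.range ⇑K2 ⊆ Set.range ⇑((α1 : ℂ) • Θ1 + (α2 : ℂ) • Θ2))
    (hranP : Set.range ⇑(adjoint ((α1 : ℂ) • Θ1 + (α2 : ℂ) • Θ2)) ⊆ Set.range ⇑K1) :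
    ∃ A B : ℝ, IsCKgFrame ν K2
      (fun ξ => (α1 : ℂ) • (Υ ξ).comp (adjoint Θ1)
        + (α2 : ℂ) • (Φ ξ).comp (adjoint Θ2)) A B := by
  obtain ⟨A1, B1, hA1, hAB1, hΥ⟩ := hΥ
  obtain ⟨A2, B2, hA2, hAB2, hΦ⟩ := hΦ
  set P := (α1 : ℂ) • Θ1 + (α2 : ℂ) • Θ2 with hP
  obtain ⟨C, hC, hK2⟩ := exists_norm_adjoint_le_of_range_subset K2 P hranK2
  obtain ⟨D, hD, hK1⟩ := exists_norm_le_norm_adjoint_of_isClosed_range K1 hK1closed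
  have hPadj (g : H2) : adjoint P g = (α1 : ℂ) • adjoint Θ1 g + (α2 : ℂ) • adjoint Θ2 g := by
    rw [hP, map_add, map_smulₛₗ, map_smulₛₗ]
    simp only [add_apply, smul_apply, Complex.conj_ofReal]
  have hnorm {α : ℝ} (x : E) : ‖(α : ℂ) • x‖ ^ 2 = α ^ 2 * ‖x‖ ^ 2 := by
    rw [norm_smul, mul_pow, Complex.norm_real, Real.norm_eq_abs, sq_abs]
  set m := min A1 A2 with hm
  have hm0 : 0 < m := lt_min hA1 hA2
  set A := m / (2 * (C * D) ^ 2) with hA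
  set B := 2 * (α1 ^ 2 * (B1 * ‖adjoint Θ1‖ ^ 2)) + 2 * (α2 ^ 2 * (B2 * ‖adjoint Θ2‖ ^ 2)) with hB
  refine ⟨A, max A B, by positivity, le_max_left _ _, fun g => ?_⟩
  obtain ⟨hi1, hl1, hu1⟩ := hΥ (adjoint Θ1 g)
  obtain ⟨hi2, hl2, hu2⟩ := hΦ (adjoint Θ2 g)
  have hu : MemLp (fun ξ => (α1 : ℂ) • Υ ξ (adjoint Θ1 g)) 2 ν :=
    ((memLp_two_iff_integrable_sq_norm (hmeasΥ _)).2 hi1).const_smul _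
  have hv : MemLp (fun ξ => (α2 : ℂ) • Φ ξ (adjoint Θ2 g)) 2 ν :=
    ((memLp_two_iff_integrable_sq_norm (hmeasΦ _)).2 hi2).const_smul _
  simp only [add_apply, smul_apply, comp_apply]
  refine ⟨(memLp_two_iff_integrable_sq_norm (hu.add hv).1).1 (hu.add hv), ?_, ?_⟩
  · rw [integral_norm_add_sq hu hv]
    have hinner : 0 ≤ (∫ ξ, (inner ℂ ((α1 : ℂ) • Υ ξ (adjoint Θ1 g))
        ((α2 : ℂ) • Φ ξ (adjoint Θ2 g)) : ℂ) ∂ν).re := by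
      simp_rw [inner_smul_left, inner_smul_right, Complex.conj_ofReal]
      rw [integral_const_mul, integral_const_mul, Complex.re_ofReal_mul, Complex.re_ofReal_mul]
      exact mul_nonneg hα1.le (mul_nonneg hα2.le (hpos g))
    simp_rw [hnorm]
    rw [integral_const_mul, integral_const_mul]
    set k1 := ‖adjoint K1 (adjoint Θ1 g)‖ with hk1
    set k2 := ‖adjoint K1 (adjoint Θ2 g)‖ with hk2
    have hk : ‖adjoint K1 (adjoint P g)‖ ≤ α1 * k1 + α2 * k2 := by
      rw [hPadj, map_add, map_smul, map_smul]
      refine (norm_add_le _ _).trans_eq ?_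
      simp [norm_smul, abs_of_pos hα1, abs_of_pos hα2, hk1, hk2]
    have hK : ‖adjoint K2 g‖ ≤ C * D * (α1 * k1 + α2 * k2) :=
      calc ‖adjoint K2 g‖ ≤ C * ‖adjoint P g‖ := hK2 g
        _ ≤ C * (D * ‖adjoint K1 (adjoint P g)‖) := by
          gcongr
          exact hK1 _ (hranP ⟨g, rfl⟩)
        _ ≤ C * (D * (α1 * k1 + α2 * k2)) := by gcongr
        _ = C * D * (α1 * k1 + α2 * k2) := by ring
    have hlow : A * ‖adjoint K2 g‖ ^ 2 ≤ α1 ^ 2 * (A1 * k1 ^ 2) + α2 ^ 2 * (A2 * k2 ^ 2) :=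
      calc A * ‖adjoint K2 g‖ ^ 2 ≤ A * (C * D * (α1 * k1 + α2 * k2)) ^ 2 := by gcongr
        _ = m * ((α1 * k1 + α2 * k2) ^ 2 / 2) := by rw [hA]; field_simp
        _ ≤ m * ((α1 * k1) ^ 2 + (α2 * k2) ^ 2) := by
          gcongr
          nlinarith [sq_nonneg (α1 * k1 - α2 * k2)]
        _ = α1 ^ 2 * (m * k1 ^ 2) + α2 ^ 2 * (m * k2 ^ 2) := by ring
        _ ≤ α1 ^ 2 * (A1 * k1 ^ 2) + α2 ^ 2 * (A2 * k2 ^ 2) := by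
          gcongr
          exacts [min_le_left _ _, min_le_right _ _]
    have h1 := mul_le_mul_of_nonneg_left hl1 (sq_nonneg α1)
    have h2 := mul_le_mul_of_nonneg_left hl2 (sq_nonneg α2)
    linarith
  · refine (integral_norm_add_sq_le_s14 hu hv).trans ?_
    simp_rw [hnorm]
    rw [integral_const_mul, integral_const_mul]
    have hB1 : 0 ≤ B1 := hA1.le.trans hAB1
    have hB2 : 0 ≤ B2 := hA2.le.trans hAB2
    calc _ ≤ 2 * (α1 ^ 2 * (B1 * (‖adjoint Θ1‖ * ‖g‖) ^ 2)) +
          2 * (α2 ^ 2 * (B2 * (‖adjoint Θ2‖ * ‖g‖) ^ 2)) := by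
          gcongr
          · exact hu1.trans (by gcongr; exact le_opNorm _ _)
          · exact hu2.trans (by gcongr; exact le_opNorm _ _)
      _ = B * ‖g‖ ^ 2 := by rw [hB]; ring
      _ ≤ max A B * ‖g‖ ^ 2 := by gcongr; exact le_max_right _ _
end
end
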